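/- Let P be a probability distribution on a finite set that is not a uniform distribution (so V(P) > 0), with H and V computed with logarithm base 2, and let 0 < ν < 1. Then the maximal number L^D_n(P, U_2 | ν) of approximable copies of U_2 from P^n satisfies lim_{n→∞} (L^D_n(P, U_2 | ν) − H(P)·n)/√n = −√V(P) · G^{−1}(ν²); equivalently L^D_n(P,U_2|ν) = H(P)n − √V(P) G^{−1}(ν²) √n + o(√n), and R^D_2(P,U_2|ν) = −√V(P) G^{−1}(ν²). -/

import Mathlib

open MeasureTheory Filter

namespace RNG

variable {α β : Type*}

/-- `P` is a probability distribution on the finite set `α`. -/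
def IsProb [Fintype α] (P : α → ℝ) : Prop :=
  (∀ x, 0 ≤ P x) ∧ ∑ x, P x = 1

open Classical in
/-- Pushforward distribution `W(P)(y) = ∑_{x : W x = y} P x`. -/
noncomputable def push [Fintype α] (W : α → β) (P : α → ℝ) : β → ℝ :=
  fun y => ∑ x, if W x = y then P x else 0

/-- Fidelity (Bhattacharyya coefficient) between distributions on the same finite set. -/
noncomputable def fid [Fintype β] (R S : β → ℝ) : ℝ :=
  ∑ y, Real.sqrt (R y * S y)

/-- Sum of the `l` largest values of `P`, i.e. the `l`-th partial sum of the
decreasing rearrangement of `P` (padded with zeros). -/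
noncomputable def topSum [Fintype α] (P : α → ℝ) (l : ℕ) : ℝ :=
  sSup {s : ℝ | ∃ A : Finset α, A.card ≤ l ∧ s = ∑ x ∈ A, P x}

/-- Majorization `P ≺ P'` (the distributions may live on different finite sets). -/
def Maj [Fintype α] [Fintype β] (P : α → ℝ) (P' : β → ℝ) : Prop :=
  ∀ l : ℕ, topSum P l ≤ topSum P' l

/-- Maximal fidelity under deterministic transformations,
`F^D(P → Q) = max {F(W(P), Q) | W : α → β}`. -/
noncomputable def FD [Fintype α] [Fintype β] (P : α → ℝ) (Q : β → ℝ) : ℝ :=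
  sSup {r : ℝ | ∃ W : α → β, r = fid (push W P) Q}

/-- Maximal fidelity under the majorization condition,
`F^M(P → Q) = max {F(P', Q) | P ≺ P', P'` a distribution on the target set`}`. -/
noncomputable def FM [Fintype α] [Fintype β] (P : α → ℝ) (Q : β → ℝ) : ℝ :=
  sSup {r : ℝ | ∃ P' : β → ℝ, IsProb P' ∧ Maj P P' ∧ r = fid P' Q}

/-- Shannon entropy (natural logarithm). -/
noncomputable def H [Fintype α] (P : α → ℝ) : ℝ := ∑ x, -(P x * Real.log (P x))

/-- Varentropy `V(P)` (natural logarithm). -/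
noncomputable def V [Fintype α] (P : α → ℝ) : ℝ :=
  ∑ x, P x * (-Real.log (P x) - H P) ^ 2

/-- Shannon entropy, base-2 logarithm. -/
noncomputable def H2 [Fintype α] (P : α → ℝ) : ℝ := ∑ x, -(P x * Real.logb 2 (P x))

/-- Varentropy, base-2 logarithm. -/
noncomputable def V2 [Fintype α] (P : α → ℝ) : ℝ :=
  ∑ x, P x * (-Real.logb 2 (P x) - H2 P) ^ 2

/-- The `n`-fold i.i.d. product distribution `P^n`. -/
noncomputable def iid [Fintype α] (P : α → ℝ) (n : ℕ) : (Fin n → α) → ℝ :=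
  fun f => ∏ i, P (f i)

/-- The uniform distribution on a two-element set. -/
noncomputable def U2 : Fin 2 → ℝ := fun _ => 1 / 2

/-- Density of the normal distribution `N(m, v)`. -/
noncomputable def normalPDF (m v t : ℝ) : ℝ :=
  (Real.sqrt (2 * Real.pi * v))⁻¹ * Real.exp (-(t - m) ^ 2 / (2 * v))

/-- Standard normal cumulative distribution function `G`. -/
noncomputable def stdG (x : ℝ) : ℝ := ∫ t in Set.Iic x, normalPDF 0 1 t

/-- Density `N_P` of `N(0, V(P))`. -/
noncomputable def NP [Fintype α] (P : α → ℝ) (x : ℝ) : ℝ := normalPDF 0 (V P) x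

/-- Density `N_{P,Q,b}` of `N(H(Q)b, (H(P)/H(Q))·V(Q))`. -/
noncomputable def NPQ [Fintype α] [Fintype β] (P : α → ℝ) (Q : β → ℝ) (b x : ℝ) : ℝ :=
  normalPDF (H Q * b) (H P / H Q * V Q) x

/-- Cdf `G_P(x) = G(x/√V(P))`. -/
noncomputable def GP [Fintype α] (P : α → ℝ) (x : ℝ) : ℝ := stdG (x / Real.sqrt (V P))

/-- Cdf `G_{P,Q,b}(x) = G(√(H(Q)/(H(P)V(Q)))·(x − H(Q)b))`. -/
noncomputable def GPQ [Fintype α] [Fintype β] (P : α → ℝ) (Q : β → ℝ) (b x : ℝ) : ℝ :=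
  stdG (Real.sqrt (H Q / (H P * V Q)) * (x - H Q * b))

/-- `I_{P,Q,b}(x) = ∫_{−∞}^x √(N_P(t) N_{P,Q,b}(t)) dt`. -/
noncomputable def IPQ [Fintype α] [Fintype β] (P : α → ℝ) (Q : β → ℝ) (b x : ℝ) : ℝ :=
  ∫ t in Set.Iic x, Real.sqrt (NP P t * NPQ P Q b t)

/-- `I_{P,Q,b}(∞) = ∫_ℝ √(N_P(t) N_{P,Q,b}(t)) dt`. -/
noncomputable def IPQinf [Fintype α] [Fintype β] (P : α → ℝ) (Q : β → ℝ) (b : ℝ) : ℝ :=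
  ∫ t : ℝ, Real.sqrt (NP P t * NPQ P Q b t)

/-- `L^D_n(P,Q|ν)`: the maximal `L` with `F^D(P^n → Q^L) ≥ ν`. -/
noncomputable def LD [Fintype α] [Fintype β] (P : α → ℝ) (Q : β → ℝ) (ν : ℝ) (n : ℕ) : ℕ :=
  sSup {L : ℕ | ν ≤ FD (iid P n) (iid Q L)}

/-- The optimal second order rate `R^D_2(P,Q|ν)`. -/
noncomputable def RD2 [Fintype α] [Fintype β] (P : α → ℝ) (Q : β → ℝ) (ν : ℝ) : ℝ :=
  sSup {b : ℝ | ∃ c : ℝ, ν ≤ c ∧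
    Tendsto (fun n : ℕ =>
      FD (iid P n) (iid Q (⌊H P / H Q * n + b * Real.sqrt n⌋₊))) atTop (nhds c)}

/-- Total mass of the atoms of weight at most `θ`. -/
noncomputable def tail [Fintype α] (P : α → ℝ) (θ : ℝ) : ℝ :=
  ∑ x, if P x ≤ θ then P x else 0

lemma push_nonneg [Fintype α] (W : α → β) {P : α → ℝ} (hP : ∀ x, 0 ≤ P x) (y : β) :
    0 ≤ push W P y :=
  Finset.sum_nonneg fun x _ => by split_ifs <;> simp [hP]

lemma push_mono [Fintype α] (W : α → β) {P Q : α → ℝ} (h : ∀ x, P x ≤ Q x) (y : β) :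
    push W P y ≤ push W Q y :=
  Finset.sum_le_sum fun x _ => by split_ifs <;> simp [h]

lemma push_add [Fintype α] (W : α → β) (P Q : α → ℝ) (y : β) :
    push W (fun x => P x + Q x) y = push W P y + push W Q y := by
  simp only [push, ← Finset.sum_add_distrib]
  exact Finset.sum_congr rfl fun x _ => by split_ifs <;> simp

lemma sum_push [Fintype α] [Fintype β] (W : α → β) (P : α → ℝ) :
    ∑ y, push W P y = ∑ x, P x := by
  classical
  simp only [push]
  rw [Finset.sum_comm]
  exact Finset.sum_congr rfl fun x _ => by simp

/-- Greedy load balancing: items of weight at most `δ` can be distributed among the bins so that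
any two bins differ by at most `δ`. -/
lemma exists_balanced [Fintype α] [Fintype β] [Nonempty β] (w : α → ℝ) {δ : ℝ} (hδ : 0 ≤ δ)
    (h0 : ∀ x, 0 ≤ w x) (h1 : ∀ x, w x ≤ δ) :
    ∃ W : α → β, ∀ y y', push W w y ≤ push W w y' + δ := by
  classical
  suffices h : ∀ s : Finset α, ∃ W : α → β, ∀ y y',
      (∑ x ∈ s, if W x = y then w x else 0) ≤ (∑ x ∈ s, if W x = y' then w x else 0) + δ by
    obtain ⟨W, hW⟩ := h Finset.univ
    exact ⟨W, fun y y' => by simpa [push] using hW y y'⟩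
  intro s
  induction s using Finset.induction_on with
  | empty => exact ⟨fun _ => Classical.arbitrary β, by simpa using hδ⟩
  | insert a s ha ih =>
    obtain ⟨W, hW⟩ := ih
    obtain ⟨y₀, hy₀⟩ := Finite.exists_min fun y => ∑ x ∈ s, if W x = y then w x else 0
    have key : ∀ y, (∑ x ∈ insert a s, if Function.update W a y₀ x = y then w x else 0) =
        (if y₀ = y then w a else 0) + ∑ x ∈ s, if W x = y then w x else 0 := by
      intro y
      rw [Finset.sum_insert ha, Function.update_self]
      congr 1
      refine Finset.sum_congr rfl fun x hx => ?_
      rw [Function.update_of_ne (by rintro rfl; exact ha hx)]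
    refine ⟨Function.update W a y₀, fun y y' => ?_⟩
    rw [key, key]
    have h2 := hW y y'
    have h3 := hy₀ y'
    have h4 : 0 ≤ if y₀ = y' then w a else 0 := by split_ifs <;> simp [h0]
    by_cases hy : y₀ = y
    · subst hy
      have := h1 a
      simp only [if_true]
      linarith
    · simp only [if_neg hy]
      linarith

lemma fid_le_FD [Fintype α] [Fintype β] (P : α → ℝ) (Q : β → ℝ) (W : α → β) :
    fid (push W P) Q ≤ FD P Q := by
  refine le_csSup ?_ ⟨W, rfl⟩
  have : {r : ℝ | ∃ W : α → β, r = fid (push W P) Q} =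
      Set.range fun W : α → β => fid (push W P) Q := by
    ext r; simp [eq_comm]
  rw [this]
  exact (Set.finite_range _).bddAbove

/-- Achievability bound for a uniform target. -/
lemma sqrt_tail_sub_le_FD [Fintype α] [Fintype β] [Nonempty β] {P : α → ℝ} (hP : ∀ x, 0 ≤ P x)
    {θ : ℝ} (hθ : 0 ≤ θ) :
    √(tail P θ - Fintype.card β * θ) ≤ FD P fun _ : β => (Fintype.card β : ℝ)⁻¹ := by
  set w : α → ℝ := fun x => if P x ≤ θ then P x else 0 with hw
  obtain ⟨W, hW⟩ := exists_balanced (β := β) w hθ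
    (fun x => by simp only [hw]; split_ifs <;> simp [hP])
    (fun x => by simp only [hw]; split_ifs with h <;> simp [h, hθ])
  set M : ℝ := (Fintype.card β : ℝ) with hM
  have hM0 : 0 < M := by simp [hM, Fintype.card_pos]
  have hbin : ∀ y, (tail P θ - M * θ) / M ≤ push W P y := by
    intro y
    have h1 : ∑ y', push W w y' ≤ ∑ _y' : β, (push W w y + θ) :=
      Finset.sum_le_sum fun y' _ => hW y' y
    rw [sum_push, Finset.sum_const, Finset.card_univ, nsmul_eq_mul, ← hM] at h1
    have h2 : push W w y ≤ push W P y := push_mono W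
      (fun x => by simp only [hw]; split_ifs <;> simp [hP]) y
    have h3 : tail P θ ≤ M * (push W w y + θ) := h1
    rw [div_le_iff₀ hM0]
    nlinarith
  refine le_trans ?_ (fid_le_FD P _ W)
  calc √(tail P θ - M * θ) = ∑ _y : β, √((tail P θ - M * θ) / M * M⁻¹) := by
        rw [Finset.sum_const, Finset.card_univ, nsmul_eq_mul, ← hM,
          show (tail P θ - M * θ) / M * M⁻¹ = (tail P θ - M * θ) / M ^ 2 by field_simp,
          Real.sqrt_div' _ (by positivity), Real.sqrt_sq hM0.le]
        field_simp
    _ ≤ fid (push W P) fun _ : β => M⁻¹ :=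
        Finset.sum_le_sum fun y _ => Real.sqrt_le_sqrt
          (mul_le_mul_of_nonneg_right (hbin y) (by positivity))

lemma sqrt_add_le_sqrt_add_sqrt {a b : ℝ} (ha : 0 ≤ a) (hb : 0 ≤ b) :
    √(a + b) ≤ √a + √b := by
  refine Real.sqrt_le_iff.2 ⟨by positivity, ?_⟩
  nlinarith [Real.sq_sqrt ha, Real.sq_sqrt hb, mul_nonneg (Real.sqrt_nonneg a) (Real.sqrt_nonneg b)]

lemma sum_sqrt_le_sqrt_card_mul {ι : Type*} (s : Finset ι) {f : ι → ℝ} (hf : ∀ i, 0 ≤ f i) :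
    ∑ i ∈ s, √(f i) ≤ √(s.card * ∑ i ∈ s, f i) := by
  refine Real.le_sqrt_of_sq_le ?_
  refine (sq_sum_le_card_mul_sum_sq (s := s) (f := fun i => √(f i))).trans_eq ?_
  congr 1
  exact Finset.sum_congr rfl fun i _ => Real.sq_sqrt (hf i)

lemma sum_sqrt_push_le [Fintype α] [Fintype β] (W : α → β) {v : α → ℝ} (hv : ∀ x, 0 ≤ v x)
    {A : Finset α} (hA : ∀ x ∉ A, v x = 0) {c : ℝ} (hc : 0 ≤ c) :
    ∑ y, √(push W v y * c) ≤ √(A.card * ((∑ x, v x) * c)) := by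
  classical
  have hsupp : ∑ y ∈ A.image W, √(push W v y * c) = ∑ y, √(push W v y * c) := by
    refine Finset.sum_subset (Finset.subset_univ _) fun y _ hy => ?_
    have : push W v y = 0 := by
      refine Finset.sum_eq_zero fun x _ => ?_
      split_ifs with hx
      · exact hA x fun hxA => hy (Finset.mem_image.2 ⟨x, hxA, hx⟩)
      · rfl
    simp [this]
  rw [← hsupp]
  refine (sum_sqrt_le_sqrt_card_mul _
    fun y => mul_nonneg (push_nonneg W hv y) hc).trans (Real.sqrt_le_sqrt ?_)
  rw [← Finset.sum_mul]
  have h1 : ((A.image W).card : ℝ) ≤ A.card := by exact_mod_cast Finset.card_image_le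
  have h2 : ∑ y ∈ A.image W, push W v y ≤ ∑ x, v x := by
    rw [← sum_push W v]
    exact Finset.sum_le_sum_of_subset_of_nonneg (Finset.subset_univ _)
      fun y _ _ => push_nonneg W hv y
  have h3 : 0 ≤ ∑ x, v x := Finset.sum_nonneg fun x _ => hv x
  have h4 : 0 ≤ ∑ y ∈ A.image W, push W v y := Finset.sum_nonneg fun y _ => push_nonneg W hv y
  gcongr

/-- Converse bound for a uniform target. -/
lemma FD_le_sqrt_add_sqrt_tail [Fintype α] [Fintype β] [Nonempty β] {P : α → ℝ} (hP : IsProb P)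
    {θ : ℝ} (hθ : 0 < θ) :
    FD P (fun _ : β => (Fintype.card β : ℝ)⁻¹) ≤ √((θ * Fintype.card β)⁻¹) + √(tail P θ) := by
  classical
  refine csSup_le ⟨_, fun _ => Classical.arbitrary β, rfl⟩ ?_
  rintro r ⟨W, rfl⟩
  set M : ℝ := (Fintype.card β : ℝ) with hM
  have hM0 : 0 < M := by simp [hM, Fintype.card_pos]
  set w : α → ℝ := fun x => if P x ≤ θ then P x else 0 with hw
  set v : α → ℝ := fun x => if P x ≤ θ then 0 else P x with hv
  have hw0 : ∀ x, 0 ≤ w x := fun x => by simp only [hw]; split_ifs <;> simp [hP.1]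
  have hv0 : ∀ x, 0 ≤ v x := fun x => by simp only [hv]; split_ifs <;> simp [hP.1]
  have hvP : ∀ x, v x ≤ P x := fun x => by simp only [hv]; split_ifs <;> simp [hP.1]
  have hvw : ∀ y, push W P y = push W v y + push W w y := fun y => by
    rw [← push_add]
    congr 1
    ext x
    simp only [hv, hw]
    split_ifs <;> simp
  have hsplit : fid (push W P) (fun _ : β => M⁻¹) ≤
      ∑ y, √(push W v y * M⁻¹) + ∑ y, √(push W w y * M⁻¹) := by
    rw [← Finset.sum_add_distrib]
    refine Finset.sum_le_sum fun y _ => ?_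
    rw [hvw, add_mul]
    exact sqrt_add_le_sqrt_add_sqrt
      (mul_nonneg (push_nonneg W hv0 y) (by positivity))
      (mul_nonneg (push_nonneg W hw0 y) (by positivity))
  have hlight : ∑ y, √(push W w y * M⁻¹) ≤ √(tail P θ) := by
    refine (sum_sqrt_le_sqrt_card_mul _
      fun y => mul_nonneg (push_nonneg W hw0 y) (by positivity)).trans_eq ?_
    rw [← Finset.sum_mul, sum_push, Finset.card_univ, ← hM]
    congr 1
    rw [mul_comm, mul_assoc, inv_mul_cancel₀ hM0.ne', mul_one, tail]
  set A : Finset α := Finset.univ.filter fun x => θ < P x with hA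
  have hAcard : (A.card : ℝ) ≤ θ⁻¹ := by
    have h1 : ∑ _x ∈ A, θ ≤ ∑ x ∈ A, P x :=
      Finset.sum_le_sum fun x hx => (Finset.mem_filter.1 hx).2.le
    have h2 : ∑ x ∈ A, P x ≤ ∑ x, P x :=
      Finset.sum_le_sum_of_subset_of_nonneg (Finset.subset_univ _) fun x _ _ => hP.1 x
    rw [Finset.sum_const, nsmul_eq_mul] at h1
    rw [hP.2] at h2
    rw [← one_div, le_div_iff₀ hθ]
    linarith
  have hheavy : ∑ y, √(push W v y * M⁻¹) ≤ √((θ * M)⁻¹) := by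
    have hvA : ∀ x ∉ A, v x = 0 := fun x hx => by
      simp only [hA, Finset.mem_filter, Finset.mem_univ, true_and, not_lt] at hx
      simp only [hv, if_pos hx]
    refine (sum_sqrt_push_le W hv0 hvA (inv_nonneg.2 hM0.le)).trans (Real.sqrt_le_sqrt ?_)
    have h1 : ∑ x, v x ≤ 1 := (Finset.sum_le_sum fun x _ => hvP x).trans_eq hP.2
    have h2 : 0 ≤ ∑ x, v x := Finset.sum_nonneg fun x _ => hv0 x
    calc (A.card : ℝ) * ((∑ x, v x) * M⁻¹) ≤ θ⁻¹ * (1 * M⁻¹) := by gcongr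
      _ = (θ * M)⁻¹ := by rw [one_mul, mul_inv]
  linarith

open ProbabilityTheory in
lemma stdG_eq (x : ℝ) : stdG x = (gaussianReal 0 1).real (Set.Iic x) := by
  rw [measureReal_def, gaussianReal_apply_eq_integral 0 one_ne_zero, ENNReal.toReal_ofReal]
  · simp [stdG, normalPDF, gaussianPDFReal]
  · exact integral_nonneg fun t => gaussianPDFReal_nonneg _ _ t

open ProbabilityTheory in
lemma stdG_strictMono : StrictMono stdG := by
  intro x y hxy
  have h : stdG y = stdG x + (gaussianReal 0 1).real (Set.Ioc x y) := by
    rw [stdG_eq, stdG_eq, ← Set.Iic_union_Ioc_eq_Iic hxy.le,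
      measureReal_union (Set.Iic_disjoint_Ioc le_rfl) measurableSet_Ioc]
  have h0 : gaussianReal 0 1 (Set.Ioc x y) ≠ 0 := fun h0 => by
    have := gaussianReal_absolutelyContinuous' 0 one_ne_zero h0
    simp [hxy.not_ge] at this
  have := ENNReal.toReal_pos h0 (measure_ne_top _ _)
  rw [← measureReal_def] at this
  linarith

lemma iid_nonneg [Fintype α] {P : α → ℝ} (hP : IsProb P) (n : ℕ) (f : Fin n → α) :
    0 ≤ iid P n f :=
  Finset.prod_nonneg fun i _ => hP.1 (f i)

lemma isProb_iid [Fintype α] {P : α → ℝ} (hP : IsProb P) (n : ℕ) : IsProb (iid P n) := by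
  classical
  refine ⟨iid_nonneg hP n, ?_⟩
  simp only [iid]
  rw [← Fintype.piFinset_univ, Finset.sum_prod_piFinset]
  simp [hP.2]

/-- The law on `α` with point masses `P`. -/
noncomputable def law [Fintype α] [MeasurableSpace α] (P : α → ℝ) : Measure α :=
  ∑ x, ENNReal.ofReal (P x) • Measure.dirac x

lemma isProbabilityMeasure_law [Fintype α] [MeasurableSpace α] {P : α → ℝ} (hP : IsProb P) :
    IsProbabilityMeasure (law P) :=
  ⟨by simp [law, Measure.finsetSum_apply, ← ENNReal.ofReal_sum_of_nonneg fun x _ => hP.1 x, hP.2]⟩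

section Law

variable [Fintype α] [MeasurableSpace α] [MeasurableSingletonClass α] {P : α → ℝ}

lemma law_singleton (P : α → ℝ) (x : α) : law P {x} = ENNReal.ofReal (P x) := by
  classical
  simp [law, Measure.finsetSum_apply, Set.indicator_apply, Finset.sum_ite_eq']

lemma integral_law (hP : IsProb P) (F : α → ℝ) : ∫ x, F x ∂(law P) = ∑ x, P x * F x := by
  have := isProbabilityMeasure_law hP
  rw [integral_fintype .of_finite]
  simp [measureReal_def, law_singleton, ENNReal.toReal_ofReal (hP.1 _)]

lemma memLp_law (hP : IsProb P) (F : α → ℝ) : MemLp F 2 (law P) := by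
  have := isProbabilityMeasure_law hP
  exact .of_discrete

lemma infinitePi_law_real (hP : IsProb P) (n : ℕ) (p : (Fin n → α) → Prop) [DecidablePred p] :
    (Measure.infinitePi fun _ : ℕ => law P).real {ω | p fun i => ω i} =
      ∑ f : Fin n → α, if p f then iid P n f else 0 := by
  classical
  have := isProbabilityMeasure_law hP
  have hm : Measurable fun (ω : ℕ → α) (i : Fin n) => ω i := by fun_prop
  have hmap := Measure.map_infinitePi_infinitePi_of_inj (P := fun _ : ℕ => law P)
    (f := fun i : Fin n => (i : ℕ)) Fin.val_injective
  have hset : {ω : ℕ → α | p fun i => ω i} = (fun (ω : ℕ → α) (i : Fin n) => ω i) ⁻¹'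
      ((Finset.univ.filter p : Finset (Fin n → α)) : Set (Fin n → α)) := by
    ext ω; simp
  rw [hset, ← sum_measureReal_preimage_singleton _ fun y _ => hm (measurableSet_singleton y),
    Finset.sum_filter]
  refine Finset.sum_congr rfl fun f _ => ?_
  congr 1
  rw [measureReal_def, ← Measure.map_apply hm (measurableSet_singleton f), hmap,
    Measure.infinitePi_singleton_of_fintype]
  simp [law_singleton, iid, ENNReal.toReal_prod, ENNReal.toReal_ofReal (hP.1 _)]

end Law

lemma tail_iid [Fintype α] {P : α → ℝ} (hP : IsProb P) (n : ℕ) (t : ℝ) :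
    tail (iid P n) (2 ^ (-t)) =
      ∑ f : Fin n → α, if t ≤ ∑ i, -Real.logb 2 (P (f i)) then iid P n f else 0 := by
  refine Finset.sum_congr rfl fun f _ => ?_
  rcases (iid_nonneg hP n f).eq_or_lt with h | h
  · simp [← h]
  · have hne : ∀ i ∈ Finset.univ, P (f i) ≠ 0 := Finset.prod_ne_zero_iff.1 h.ne'
    have : iid P n f ≤ 2 ^ (-t) ↔ t ≤ ∑ i, -Real.logb 2 (P (f i)) := by
      rw [← Real.logb_le_iff_le_rpow one_lt_two h, iid, Real.logb_prod _ _ hne,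
        Finset.sum_neg_distrib]
      exact le_neg.symm
    simp only [this]

open ProbabilityTheory in
/-- The central limit theorem for the self-information of an i.i.d. source. -/
lemma tendsto_tail_iid [Fintype α] {P : α → ℝ} (hP : IsProb P) (hV : 0 < V2 P) {t : ℕ → ℝ}
    {b : ℝ} (ht : Tendsto (fun n : ℕ => (t n - H2 P * n) / √n) atTop (nhds b)) :
    Tendsto (fun n => tail (iid P n) (2 ^ (-t n))) atTop (nhds (stdG (-b / √(V2 P)))) := by
  classical
  let _ : MeasurableSpace α := ⊤
  have hlaw := isProbabilityMeasure_law hP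
  set μ := Measure.infinitePi fun _ : ℕ => law P with hμ
  set F : α → ℝ := fun x => -Real.logb 2 (P x) with hF
  set X : ℕ → (ℕ → α) → ℝ := fun i ω => F (ω i) with hX
  have hFm : Measurable F := measurable_of_finite F
  have hXlaw : ∀ i, MeasurePreserving (fun ω : ℕ → α => ω i) μ (law P) := fun i =>
    measurePreserving_eval_infinitePi _ i
  have hident : ∀ i, IdentDistrib (X i) (X 0) μ μ := fun i =>
    IdentDistrib.comp (u := F) ⟨(hXlaw i).measurable.aemeasurable,
      (hXlaw 0).measurable.aemeasurable, by rw [(hXlaw i).map_eq, (hXlaw 0).map_eq]⟩ hFm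
  have hindep : iIndepFun X μ := iIndepFun_infinitePi fun _ => hFm
  have hL2 : MemLp (X 0) 2 μ := (memLp_law hP F).comp_measurePreserving (hXlaw 0)
  have hint : ∀ K : α → ℝ, ∫ ω, K (ω 0) ∂μ = ∑ x, P x * K x := fun K => by
    rw [← integral_law hP K, ← (hXlaw 0).map_eq,
      integral_map (hXlaw 0).measurable.aemeasurable
        (measurable_of_finite K).aestronglyMeasurable]
  have hmean : μ[X 0] = H2 P := by
    refine (hint F).trans ?_
    simp only [H2, hF, mul_neg]
  have hvar : Var[X 0; μ] = V2 P := by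
    rw [variance_eq_integral hL2.aestronglyMeasurable.aemeasurable, hmean]
    exact hint fun x => (F x - H2 P) ^ 2
  set σ := √(V2 P) with hσ
  have hσ0 : 0 < σ := Real.sqrt_pos.2 hV
  have hY : HasLaw (fun z : ℝ => -σ * z) (gaussianReal 0 Var[X 0; μ].toNNReal)
      (gaussianReal 0 1) := by
    have hv : V2 P = (-σ) ^ 2 := by rw [neg_sq, hσ, Real.sq_sqrt hV.le]
    convert gaussianReal_const_mul (HasLaw.id (μ := gaussianReal 0 1)) (-σ) using 2
    · simp
    · simp
    · apply NNReal.eq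
      rw [hvar, Real.coe_toNNReal _ hV.le, mul_one, NNReal.coe_mk, hv]
  have hclt := tendstoInDistribution_inv_sqrt_mul_sum_sub hY hL2 hindep hident
  rw [hmean] at hclt
  have hconst : TendstoInMeasure μ (fun (n : ℕ) (_ : ℕ → α) => -((t n - H2 P * n) / √n)) atTop
      (fun _ => -b) :=
    tendstoInMeasure_of_tendsto_ae (fun n => aestronglyMeasurable_const)
      (ae_of_all _ fun _ => ht.neg)
  have hsl := hclt.add_of_tendstoInMeasure_const hconst (fun n => aemeasurable_const)
  have hlim := ProbabilityMeasure.tendsto_measure_of_null_frontier_of_tendsto' hsl.tendsto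
    (E := Set.Ici 0) ?_
  · have hlim' := (ENNReal.tendsto_toReal (by
      simp only [ProbabilityMeasure.coe_mk]
      exact measure_ne_top _ _)).comp hlim
    have hval : (((gaussianReal 0 1).map fun z : ℝ => -σ * z + -b) (Set.Ici 0)).toReal =
        stdG (-b / σ) := by
      rw [Measure.map_apply (by fun_prop) measurableSet_Ici, stdG_eq, measureReal_def]
      congr 2
      ext z
      simp only [Set.mem_preimage, Set.mem_Ici, Set.mem_Iic]
      rw [le_div_iff₀ hσ0]
      constructor <;> intro h <;> linarith
    rw [← hval]
    refine hlim'.congr' ?_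
    filter_upwards [eventually_gt_atTop 0] with n hn
    have hn0 : 0 < √(n : ℝ) := Real.sqrt_pos.2 (by exact_mod_cast hn)
    rw [tail_iid hP, ← infinitePi_law_real hP n fun f => t n ≤ ∑ i, -Real.logb 2 (P (f i)),
      measureReal_def]
    simp only [Function.comp, ProbabilityMeasure.coe_mk]
    rw [Measure.map_apply_of_aemeasurable (hsl.forall_aemeasurable n) measurableSet_Ici]
    congr 2
    ext ω
    simp only [Set.mem_preimage, Set.mem_Ici, Set.mem_ofPred_eq, Pi.add_apply, hX, hF]
    rw [Fin.sum_univ_eq_sum_range (fun i => -Real.logb 2 (P (ω i))) n]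
    rw [inv_mul_eq_div, ← sub_eq_add_neg, ← sub_div, le_div_iff₀ hn0, zero_mul]
    constructor <;> intro h <;> linarith
  · rw [frontier_Ici]
    simp only [ProbabilityMeasure.coe_mk]
    rw [Measure.map_apply (by fun_prop) (measurableSet_singleton _)]
    refine gaussianReal_absolutelyContinuous 0 one_ne_zero ?_
    have : (fun z : ℝ => -σ * z + -b) ⁻¹' {0} ⊆ {-b / σ} := by
      intro z hz
      simp only [Set.mem_preimage, Set.mem_singleton_iff] at hz ⊢
      rw [eq_div_iff hσ0.ne']
      linarith
    exact measure_mono_null this (by simp)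

lemma iid_U2 (L : ℕ) : iid U2 L = fun _ => (Fintype.card (Fin L → Fin 2) : ℝ)⁻¹ := by
  ext f
  simp [iid, U2]

lemma FD_iid_U2_le [Fintype α] {P : α → ℝ} (hP : IsProb P) {L₀ L : ℕ} (hL : L₀ ≤ L) (γ : ℝ) :
    FD P (iid U2 L) ≤ √(2 ^ (-γ)) + √(tail P (2 ^ (-(L₀ - γ)))) := by
  rw [iid_U2]
  refine (FD_le_sqrt_add_sqrt_tail hP (θ := 2 ^ (-(L₀ - γ))) (by positivity)).trans ?_
  gcongr
  have h2 : (2 : ℝ) ^ L₀ ≤ 2 ^ L := pow_le_pow_right₀ one_le_two hL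
  calc ((2 : ℝ) ^ (-(L₀ - γ)) * Fintype.card (Fin L → Fin 2))⁻¹
      ≤ ((2 : ℝ) ^ (-(L₀ - γ)) * 2 ^ (L₀ : ℝ))⁻¹ := by
        simp only [Fintype.card_fun, Fintype.card_fin, Nat.cast_pow, Nat.cast_ofNat,
          Real.rpow_natCast]
        gcongr
    _ = 2 ^ (-γ) := by
        rw [← Real.rpow_add two_pos, ← Real.rpow_neg two_pos.le]
        congr 1
        ring

lemma sqrt_tail_sub_le_FD_iid_U2 [Fintype α] {P : α → ℝ} (hP : IsProb P) (L : ℕ) (γ : ℝ) :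
    √(tail P (2 ^ (-(L + γ))) - 2 ^ (-γ)) ≤ FD P (iid U2 L) := by
  have h := sqrt_tail_sub_le_FD (β := Fin L → Fin 2) hP.1 (θ := 2 ^ (-(L + γ))) (by positivity)
  rw [← iid_U2] at h
  convert h using 3
  simp only [Fintype.card_fun, Fintype.card_fin, Nat.cast_pow, Nat.cast_ofNat]
  rw [← Real.rpow_natCast, ← Real.rpow_add two_pos]
  congr 1
  ring

lemma tendsto_sqrt_sqrt : Tendsto (fun n : ℕ => √√(n : ℝ)) atTop atTop :=
  Real.tendsto_sqrt_atTop.comp (Real.tendsto_sqrt_atTop.comp tendsto_natCast_atTop_atTop)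

lemma tendsto_two_rpow_neg_sqrt_sqrt :
    Tendsto (fun n : ℕ => (2 : ℝ) ^ (-√√(n : ℝ))) atTop (nhds 0) :=
  (tendsto_rpow_atBot_of_base_gt_one 2 one_lt_two).comp
    (tendsto_neg_atTop_atBot.comp tendsto_sqrt_sqrt)

lemma tendsto_sqrt_sqrt_div : Tendsto (fun n : ℕ => √√(n : ℝ) / √n) atTop (nhds 0) := by
  simp_rw [Real.sqrt_div_self]
  exact tendsto_inv_atTop_zero.comp tendsto_sqrt_sqrt

section Asymptotics

variable [Fintype α] {P : α → ℝ} {L : ℕ → ℕ} {b : ℝ}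

lemma tendsto_upper (hP : IsProb P) (hV : 0 < V2 P)
    (hL : Tendsto (fun n : ℕ => ((L n : ℝ) - H2 P * n) / √n) atTop (nhds b)) :
    Tendsto (fun n : ℕ => √(2 ^ (-√√(n : ℝ))) + √(tail (iid P n) (2 ^ (-(L n - √√(n : ℝ))))))
      atTop (nhds √(stdG (-b / √(V2 P)))) := by
  have ht : Tendsto (fun n : ℕ => (((L n : ℝ) - √√n) - H2 P * n) / √n) atTop (nhds b) := by
    simpa [← sub_div, sub_right_comm] using hL.sub tendsto_sqrt_sqrt_div
  simpa using tendsto_two_rpow_neg_sqrt_sqrt.sqrt.add (tendsto_tail_iid hP hV ht).sqrt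

/-- If the target length is `H n + b √n + o(√n)`, the optimal fidelity tends to `√G(-b / √V)`. -/
lemma tendsto_FD_iid_U2 (hP : IsProb P) (hV : 0 < V2 P)
    (hL : Tendsto (fun n : ℕ => ((L n : ℝ) - H2 P * n) / √n) atTop (nhds b)) :
    Tendsto (fun n => FD (iid P n) (iid U2 (L n))) atTop (nhds √(stdG (-b / √(V2 P)))) := by
  have ht : Tendsto (fun n : ℕ => (((L n : ℝ) + √√n) - H2 P * n) / √n) atTop (nhds b) := by
    simpa [← add_div, sub_add_eq_add_sub] using hL.add tendsto_sqrt_sqrt_div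
  have hlow : Tendsto (fun n : ℕ =>
      √(tail (iid P n) (2 ^ (-(L n + √√(n : ℝ)))) - 2 ^ (-√√(n : ℝ)))) atTop
      (nhds √(stdG (-b / √(V2 P)))) := by
    simpa using ((tendsto_tail_iid hP hV ht).sub tendsto_two_rpow_neg_sqrt_sqrt).sqrt
  exact tendsto_of_tendsto_of_tendsto_of_le_of_le hlow (tendsto_upper hP hV hL)
    (fun n => sqrt_tail_sub_le_FD_iid_U2 (isProb_iid hP n) _ _)
    (fun n => FD_iid_U2_le (isProb_iid hP n) le_rfl _)

end Asymptotics

lemma H2_pos [Fintype α] {P : α → ℝ} (hP : IsProb P) (hV : 0 < V2 P) : 0 < H2 P := by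
  have hle : ∀ x, P x ≤ 1 := fun x => hP.2 ▸
    Finset.single_le_sum (f := P) (fun y _ => hP.1 y) (Finset.mem_univ x)
  have hterm : ∀ x ∈ Finset.univ, 0 ≤ -(P x * Real.logb 2 (P x)) := fun x _ => by
    rw [← mul_neg]
    exact mul_nonneg (hP.1 x) (neg_nonneg.2 (Real.logb_nonpos one_lt_two (hP.1 x) (hle x)))
  refine (Finset.sum_nonneg hterm).lt_of_ne fun h0 => hV.ne' ?_
  have h1 := (Finset.sum_eq_zero_iff_of_nonneg hterm).1 h0.symm
  refine Finset.sum_eq_zero fun x hx => ?_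
  have h2 : H2 P = 0 := h0.symm
  have h3 := neg_eq_zero.1 (h1 x hx)
  rw [h2, sub_zero, neg_sq, sq, ← mul_assoc, h3, zero_mul]

lemma H_div_H_U2 [Fintype α] (P : α → ℝ) : H P / H U2 = H2 P := by
  have h : H U2 = Real.log 2 := by simp [H, U2]
  rw [h, H, H2, Finset.sum_div]
  exact Finset.sum_congr rfl fun x _ => by rw [Real.logb]; ring

lemma eventually_nonneg_mul_add_mul_sqrt {h : ℝ} (hh : 0 < h) (b : ℝ) :
    ∀ᶠ n : ℕ in atTop, 0 ≤ h * n + b * √n := by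
  have h1 : Tendsto (fun n : ℕ => √(n : ℝ)) atTop atTop :=
    Real.tendsto_sqrt_atTop.comp tendsto_natCast_atTop_atTop
  filter_upwards [h1.eventually_ge_atTop (-b / h)] with n hn
  rw [div_le_iff₀ hh] at hn
  have h2 : (n : ℝ) = √n * √n := (Real.mul_self_sqrt n.cast_nonneg).symm
  have h3 : h * n + b * √n = √n * (√n * h + b) := by rw [mul_add, ← mul_assoc, ← h2]; ring
  rw [h3]
  exact mul_nonneg (Real.sqrt_nonneg _) (by linarith)

lemma tendsto_floor_sub_div {h : ℝ} (hh : 0 < h) (b : ℝ) :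
    Tendsto (fun n : ℕ => ((⌊h * n + b * √n⌋₊ : ℝ) - h * n) / √n) atTop (nhds b) := by
  have h1 : Tendsto (fun n : ℕ => b - 1 / √(n : ℝ)) atTop (nhds b) := by
    have h1 : Tendsto (fun n : ℕ => √(n : ℝ)) atTop atTop :=
      Real.tendsto_sqrt_atTop.comp tendsto_natCast_atTop_atTop
    simpa using tendsto_const_nhds.sub (tendsto_inv_atTop_zero.comp h1)
  refine tendsto_of_tendsto_of_tendsto_of_le_of_le' h1 tendsto_const_nhds ?_ ?_
  · filter_upwards [eventually_gt_atTop 0] with n hn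
    have hn0 : 0 < √(n : ℝ) := Real.sqrt_pos.2 (by exact_mod_cast hn)
    have h2 := Nat.lt_floor_add_one (h * n + b * √n)
    rw [le_div_iff₀ hn0, sub_mul, one_div, inv_mul_cancel₀ hn0.ne']
    linarith
  · filter_upwards [eventually_gt_atTop 0, eventually_nonneg_mul_add_mul_sqrt hh b] with n hn hn1
    have hn0 : 0 < √(n : ℝ) := Real.sqrt_pos.2 (by exact_mod_cast hn)
    have h2 := Nat.floor_le hn1
    rw [div_le_iff₀ hn0]
    linarith

/-- second order expansion of `L^D_n(P, U_2 | ν)`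
(entropy and varentropy in base 2); `g = G⁻¹(ν²)`. -/
theorem second_order_rate_uniform_target {X : Type*} [Fintype X]
    (P : X → ℝ) (hP : IsProb P) (hV : 0 < V2 P)
    (ν : ℝ) (hν : 0 < ν ∧ ν < 1) (g : ℝ) (hg : stdG g = ν ^ 2) :
    Tendsto (fun n : ℕ => ((LD P U2 ν n : ℝ) - H2 P * n) / Real.sqrt n) atTop
      (nhds (-(Real.sqrt (V2 P) * g))) ∧
    RD2 P U2 ν = -(Real.sqrt (V2 P) * g) := by
  have hσ : 0 < √(V2 P) := Real.sqrt_pos.2 hV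
  have hH := H2_pos hP hV
  have hνg : ν = √(stdG g) := by rw [hg, Real.sqrt_sq hν.1.le]
  have hg0 : 0 < stdG g := by rw [hg]; exact pow_pos hν.1 2
  constructor
  · have hupper : ∀ b, -(√(V2 P) * g) < b →
        ∀ᶠ n : ℕ in atTop, ∀ L ∈ {L : ℕ | ν ≤ FD (iid P n) (iid U2 L)},
          L ≤ ⌊H2 P * n + b * √n⌋₊ := by
      intro b hb
      have hlt : √(stdG (-b / √(V2 P))) < ν := by
        rw [hνg]
        refine Real.sqrt_lt_sqrt ?_ (stdG_strictMono ?_)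
        · rw [stdG_eq]; exact measureReal_nonneg
        · rw [div_lt_iff₀ hσ]; linarith
      filter_upwards [(tendsto_upper hP hV (tendsto_floor_sub_div hH b)).eventually_lt_const hlt]
        with n hn L hL
      by_contra! hL'
      exact absurd (hL.trans (FD_iid_U2_le (isProb_iid hP n) hL'.le _)) hn.not_ge
    refine tendsto_order.2 ⟨fun a ha => ?_, fun a ha => ?_⟩
    · obtain ⟨b, hab, hb⟩ := exists_between ha
      have hlt : ν < √(stdG (-b / √(V2 P))) := by
        rw [hνg]
        refine Real.sqrt_lt_sqrt hg0.le (stdG_strictMono ?_)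
        rw [lt_div_iff₀ hσ]; linarith
      have hfl := tendsto_floor_sub_div hH b
      filter_upwards [(tendsto_FD_iid_U2 hP hV hfl).eventually_const_lt hlt,
        hfl.eventually_const_lt hab, hupper _ (lt_add_one _)] with n hn hn1 hbdd
      refine hn1.trans_le ?_
      gcongr
      exact le_csSup ⟨_, hbdd⟩ hn.le
    · obtain ⟨b, hb, hba⟩ := exists_between ha
      filter_upwards [hupper b hb, (tendsto_floor_sub_div hH b).eventually_lt_const hba]
        with n hn hn1
      refine lt_of_le_of_lt ?_ hn1
      gcongr
      exact csSup_le' hn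
  · have hset : {b : ℝ | ∃ c : ℝ, ν ≤ c ∧ Tendsto (fun n : ℕ =>
        FD (iid P n) (iid U2 (⌊H P / H U2 * n + b * √n⌋₊))) atTop (nhds c)} =
        Set.Iic (-(√(V2 P) * g)) := by
      rw [H_div_H_U2]
      ext b
      have hlim := tendsto_FD_iid_U2 hP hV (tendsto_floor_sub_div hH b)
      have hiff : ν ≤ √(stdG (-b / √(V2 P))) ↔ b ≤ -(√(V2 P) * g) := by
        rw [hνg, Real.sqrt_le_sqrt_iff' hg0, stdG_strictMono.le_iff_le, le_div_iff₀ hσ]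
        constructor <;> intro h <;> linarith
      simp only [Set.mem_ofPred_eq, Set.mem_Iic]
      rw [← hiff]
      exact ⟨fun ⟨c, hc, hc'⟩ => tendsto_nhds_unique hc' hlim ▸ hc, fun h => ⟨_, h, hlim⟩⟩
    rw [RD2, hset, csSup_Iic]

end RNG
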